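/- For all s, t ∈ T, the generalized distances satisfy d̄₁(s,t) + d̄₂(s,t) ≤ max{2^{−p₁ k(s,t)}, 2^{−p₂ k(s,t)}} · τ̄(s,t). -/

import Mathlib

open MeasureTheory

open Filter Topology

/-- The chaining recursion either stays strictly increasing or, because `sInf ∅ = 0`, returns to
`0` infinitely often. -/
theorem strictMono_or_frequently_eq_zero (p₁ p₂ : ℝ) (hp₁ : 0 ≤ p₁) (hp₂ : 0 ≤ p₂)
    (E₁ E₂ : ℕ → ℝ) (hE₁ : ∀ n, 0 ≤ E₁ n) (hE₂ : ∀ n, 0 ≤ E₂ n)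
    (ha₁ : Antitone E₁) (ha₂ : Antitone E₂)
    (hs₁ : Summable fun n : ℕ => (2:ℝ) ^ (p₁ * n) * E₁ n)
    (hs₂ : Summable fun n : ℕ => (2:ℝ) ^ (p₂ * n) * E₂ n)
    (n : ℕ → ℕ)
    (hn : ∀ i, n (i + 1) = sInf {l : ℕ | n i < l ∧
      2 * ((2:ℝ) ^ (p₁ * l) * E₁ l + (2:ℝ) ^ (p₂ * l) * E₂ l) <
        (2:ℝ) ^ (p₁ * l) * E₁ (n i) + (2:ℝ) ^ (p₂ * l) * E₂ (n i)}) :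
    StrictMono n ∨ ∃ᶠ i in atTop, n i = 0 := by
  have step : ∀ i, n (i + 1) ≠ 0 → n i < n (i + 1) := by
    intro i hi
    rw [hn i] at hi ⊢
    exact (Nat.sInf_mem (Nat.nonempty_of_pos_sInf (Nat.pos_of_ne_zero hi))).1
  by_cases hz : ∃ N, E₁ N = 0 ∧ E₂ N = 0
  · right
    obtain ⟨N, h₁, h₂⟩ := hz
    rw [frequently_atTop]
    intro i
    by_contra! hcon
    have hmono : StrictMono fun j => n (i + j) :=
      strictMono_nat_of_lt_succ fun j => step (i + j) (hcon _ (by omega))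
    have hlarge : N ≤ n (i + N) := hmono.le_apply
    have e₁ : E₁ (n (i + N)) = 0 := le_antisymm (h₁ ▸ ha₁ hlarge) (hE₁ _)
    have e₂ : E₂ (n (i + N)) = 0 := le_antisymm (h₂ ▸ ha₂ hlarge) (hE₂ _)
    refine hcon (i + N + 1) (by omega) ?_
    rw [hn, Nat.sInf_eq_zero]
    right
    rw [Set.eq_empty_iff_forall_notMem]
    rintro l ⟨-, hl⟩
    rw [e₁, e₂] at hl
    have := mul_nonneg (Real.rpow_nonneg (zero_le_two (α := ℝ)) (p₁ * l)) (hE₁ l)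
    have := mul_nonneg (Real.rpow_nonneg (zero_le_two (α := ℝ)) (p₂ * l)) (hE₂ l)
    linarith
  · left
    refine strictMono_nat_of_lt_succ fun i => ?_
    have hpos : 0 < E₁ (n i) + E₂ (n i) := by
      refine lt_of_le_of_ne (add_nonneg (hE₁ _) (hE₂ _)) fun h => hz ⟨n i, ?_, ?_⟩ <;>
        linarith [hE₁ (n i), hE₂ (n i)]
    have hlim : Tendsto (fun l : ℕ => 2 * ((2:ℝ) ^ (p₁ * l) * E₁ l + (2:ℝ) ^ (p₂ * l) * E₂ l))
        atTop (𝓝 0) := by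
      simpa using (hs₁.tendsto_atTop_zero.add hs₂.tendsto_atTop_zero).const_mul 2
    obtain ⟨l, hl, hil⟩ := ((hlim.eventually_lt_const hpos).and (eventually_gt_atTop (n i))).exists
    refine step i fun h0 => ?_
    rw [hn i, Nat.sInf_eq_zero] at h0
    rcases h0 with ⟨h0, -⟩ | h0
    · exact Nat.not_lt_zero _ h0
    refine Set.eq_empty_iff_forall_notMem.1 h0 l ⟨hil, hl.trans_le (add_le_add ?_ ?_)⟩
    · exact le_mul_of_one_le_left (hE₁ _) (Real.one_le_rpow one_le_two (by positivity))
    · exact le_mul_of_one_le_left (hE₂ _) (Real.one_le_rpow one_le_two (by positivity))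

theorem tsum_chain_le (p : ℝ) (hp : 0 ≤ p) (E : ℕ → ℝ) (hE : ∀ n, 0 ≤ E n) (ha : Antitone E)
    (hs : Summable fun n : ℕ => (2:ℝ) ^ (p * n) * E n) (k : ℕ) (n : ℕ → ℕ) (hn0 : n 0 = k + 1)
    (hn : StrictMono n ∨ ∃ᶠ i in atTop, n i = 0) :
    ∑' i, E (n i) ≤ (2:ℝ) ^ (-(p * k)) *
      ∑' l : ℕ, (2:ℝ) ^ (p * ((l + (k + 1) : ℕ) : ℝ)) * E (l + (k + 1)) := by
  have hnn : ∀ l : ℕ, 0 ≤ (2:ℝ) ^ (p * ((l + (k + 1) : ℕ) : ℝ)) * E (l + (k + 1)) :=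
    fun l => mul_nonneg (by positivity) (hE _)
  rcases hn with hn | hn
  · have hle : ∀ l : ℕ, E (l + (k + 1)) ≤
        (2:ℝ) ^ (-(p * k)) * ((2:ℝ) ^ (p * ((l + (k + 1) : ℕ) : ℝ)) * E (l + (k + 1))) := by
      intro l
      rw [← mul_assoc, ← Real.rpow_add two_pos]
      refine le_mul_of_one_le_left (hE _) (Real.one_le_rpow one_le_two ?_)
      push_cast
      have : 0 ≤ p * (l + 1) := by positivity
      linarith
    have hs' := ((summable_nat_add_iff (k + 1)).2 hs).mul_left ((2:ℝ) ^ (-(p * k)))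
    have hsE : Summable fun l => E (l + (k + 1)) :=
      Summable.of_nonneg_of_le (fun l => hE _) hle hs'
    have hk : ∀ i, k + 1 ≤ n i := fun i => hn0 ▸ hn.monotone (Nat.zero_le i)
    have hinj : Function.Injective fun i => n i - (k + 1) := fun i j hij =>
      hn.injective (by have := hk i; have := hk j; simp only at hij; omega)
    have heq : (fun i => E (n i)) = (fun l => E (l + (k + 1))) ∘ fun i => n i - (k + 1) :=
      funext fun i => by simp [Nat.sub_add_cancel (hk i)]
    calc ∑' i, E (n i) ≤ ∑' l, E (l + (k + 1)) := by
          rw [heq]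
          exact tsum_comp_le_tsum_of_inj hsE (fun l => hE _) hinj
      _ ≤ _ := by
          rw [← tsum_mul_left]
          exact hsE.tsum_le_tsum hle hs'
  · have hzero : ∑' i, E (n i) = 0 := by
      by_cases hS : Summable fun i => E (n i)
      · have h0 : E 0 ≤ 0 := by
          by_contra! hpos
          obtain ⟨i, hi, hlt⟩ :=
            (hn.and_eventually (hS.tendsto_atTop_zero.eventually_lt_const hpos)).exists
          rw [hi] at hlt
          exact lt_irrefl _ hlt
        have : ∀ i, E (n i) = 0 := fun i =>
          le_antisymm ((ha (Nat.zero_le _)).trans h0) (hE _)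
        simp [this]
      · exact tsum_eq_zero_of_not_summable hS
    rw [hzero]
    exact mul_nonneg (by positivity) (tsum_nonneg hnn)

theorem one_le_rpow_neg_mul_geom (p : ℝ) (hp : 0 < p) (k : ℕ) :
    1 ≤ (2:ℝ) ^ (-(p * k)) * (((2:ℝ) ^ (p * ((k : ℝ) + 1)) - 1) / ((2:ℝ) ^ p - 1)) := by
  have h1 : 1 < (2:ℝ) ^ p := Real.one_lt_rpow one_lt_two hp
  have h2 : 1 ≤ (2:ℝ) ^ (p * k) := Real.one_le_rpow one_le_two (by positivity)
  have h3 : (2:ℝ) ^ (p * k) ≤ ((2:ℝ) ^ (p * ((k : ℝ) + 1)) - 1) / ((2:ℝ) ^ p - 1) := by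
    rw [le_div_iff₀ (by linarith), mul_add, mul_one, Real.rpow_add two_pos]
    linarith
  rw [Real.rpow_neg zero_le_two]
  calc (1:ℝ) = ((2:ℝ) ^ (p * k))⁻¹ * (2:ℝ) ^ (p * k) := (inv_mul_cancel₀ (by positivity)).symm
    _ ≤ _ := by gcongr

theorem sInf_image_nonneg {T : Type*} (f : T → ℝ) (hf : ∀ y, 0 ≤ f y) (A : Set T) :
    0 ≤ sInf (f '' A) :=
  Real.sInf_nonneg (by rintro _ ⟨y, -, rfl⟩; exact hf y)

theorem antitone_sInf_image {T : Type*} (f : T → ℝ) (hf : ∀ y, 0 ≤ f y) (A : ℕ → Finset T)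
    (hne : ∀ n, (A n).Nonempty) (hmono : ∀ n, A n ⊆ A (n + 1)) :
    Antitone fun n => sInf (f '' (A n : Set T)) :=
  antitone_nat_of_succ_le fun n =>
    csInf_le_csInf ⟨0, by rintro _ ⟨y, -, rfl⟩; exact hf y⟩
      ((Finset.coe_nonempty.2 (hne n)).image f)
      (Set.image_mono (Finset.coe_subset.2 (hmono n)))

/-- For all `s, t ∈ T`, the generalized distances
`d̄ⱼ(s,t) = Σᵢ dⱼ(t,T_{nᵢ(t)}) + dⱼ(s,t) + Σᵢ dⱼ(s,T_{nᵢ(s)})` (where `n₀(x) = k(s,t)+1` and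
`nᵢ(x)` follows the two-distance chaining recursion) satisfy
`d̄₁(s,t) + d̄₂(s,t) ≤ max{2^{-p₁ k(s,t)}, 2^{-p₂ k(s,t)}} τ̄(s,t)`. -/
theorem stmt_13
    {T : Type*} (d₁ d₂ : T → T → ℝ)
    (hd₁0 : ∀ x y, 0 ≤ d₁ x y) (hd₁symm : ∀ x y, d₁ x y = d₁ y x)
    (hd₁refl : ∀ x, d₁ x x = 0) (hd₁tri : ∀ x y z, d₁ x z ≤ d₁ x y + d₁ y z)
    (hd₂0 : ∀ x y, 0 ≤ d₂ x y) (hd₂symm : ∀ x y, d₂ x y = d₂ y x)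
    (hd₂refl : ∀ x, d₂ x x = 0) (hd₂tri : ∀ x y z, d₂ x z ≤ d₂ x y + d₂ y z)
    (p₁ p₂ : ℝ) (hp₁ : 1 ≤ p₁) (hp₂ : 1 ≤ p₂)
    (Tn : ℕ → Finset T)
    (hTne : ∀ n, (Tn n).Nonempty)
    (hTmono : ∀ n, Tn n ⊆ Tn (n + 1))
    (hTdense : ∀ x : T, ∀ ε > (0:ℝ), ∃ n, ∃ u ∈ Tn n, d₁ x u < ε ∧ d₂ x u < ε)
    (D₁ D₂ : T → ℕ → ℝ)
    (hD₁ : ∀ x n, D₁ x n = sInf ((d₁ x) '' (Tn n : Set T)))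
    (hD₂ : ∀ x n, D₂ x n = sInf ((d₂ x) '' (Tn n : Set T)))
    (hsum₁ : ∀ x, Summable fun n : ℕ => (2:ℝ) ^ (p₁ * n) * D₁ x n)
    (hsum₂ : ∀ x, Summable fun n : ℕ => (2:ℝ) ^ (p₂ * n) * D₂ x n)
    (σ₁ σ₂ : ℕ → T → ℝ)
    (hσ₁ : ∀ m x, σ₁ m x = ∑' l : ℕ, (2:ℝ) ^ (p₁ * ((l + m : ℕ) : ℝ)) * D₁ x (l + m))
    (hσ₂ : ∀ m x, σ₂ m x = ∑' l : ℕ, (2:ℝ) ^ (p₂ * ((l + m : ℕ) : ℝ)) * D₂ x (l + m))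
    (s t : T) (k : ℕ)
    (hkmem : (2:ℝ) ^ (p₁ * k) * (D₁ s k + D₁ t k) + (2:ℝ) ^ (p₂ * k) * (D₂ s k + D₂ t k) ≥
      (2:ℝ) ^ (p₁ * k) * d₁ s t + (2:ℝ) ^ (p₂ * k) * d₂ s t)
    (hkmax : ∀ l : ℕ,
      (2:ℝ) ^ (p₁ * l) * (D₁ s l + D₁ t l) + (2:ℝ) ^ (p₂ * l) * (D₂ s l + D₂ t l) ≥
        (2:ℝ) ^ (p₁ * l) * d₁ s t + (2:ℝ) ^ (p₂ * l) * d₂ s t → l ≤ k)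
    (nn : T → ℕ → ℕ)
    (hnn0 : ∀ x, nn x 0 = k + 1)
    (hnnrec : ∀ x i, nn x (i + 1) = sInf {l : ℕ | nn x i < l ∧
      2 * ((2:ℝ) ^ (p₁ * l) * D₁ x l + (2:ℝ) ^ (p₂ * l) * D₂ x l) <
        (2:ℝ) ^ (p₁ * l) * D₁ x (nn x i) + (2:ℝ) ^ (p₂ * l) * D₂ x (nn x i)}) :
    ((∑' i : ℕ, D₁ t (nn t i)) + d₁ s t + (∑' i : ℕ, D₁ s (nn s i))) +
    ((∑' i : ℕ, D₂ t (nn t i)) + d₂ s t + (∑' i : ℕ, D₂ s (nn s i))) ≤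
      max ((2:ℝ) ^ (-(p₁ * k))) ((2:ℝ) ^ (-(p₂ * k))) *
        ((σ₁ (k + 1) s + σ₁ (k + 1) t + σ₂ (k + 1) s + σ₂ (k + 1) t) +
          ((2:ℝ) ^ (p₁ * ((k : ℝ) + 1)) - 1) / ((2:ℝ) ^ p₁ - 1) * d₁ s t +
          ((2:ℝ) ^ (p₂ * ((k : ℝ) + 1)) - 1) / ((2:ℝ) ^ p₂ - 1) * d₂ s t) := by
  have hp₁' : 0 < p₁ := by linarith
  have hp₂' : 0 < p₂ := by linarith
  have hE₁ : ∀ x n, 0 ≤ D₁ x n := fun x n => hD₁ x n ▸ sInf_image_nonneg _ (hd₁0 x) _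
  have hE₂ : ∀ x n, 0 ≤ D₂ x n := fun x n => hD₂ x n ▸ sInf_image_nonneg _ (hd₂0 x) _
  have ha₁ : ∀ x, Antitone (D₁ x) := fun x => by
    rw [funext (hD₁ x)]
    exact antitone_sInf_image _ (hd₁0 x) Tn hTne hTmono
  have ha₂ : ∀ x, Antitone (D₂ x) := fun x => by
    rw [funext (hD₂ x)]
    exact antitone_sInf_image _ (hd₂0 x) Tn hTne hTmono
  set M := max ((2:ℝ) ^ (-(p₁ * k))) ((2:ℝ) ^ (-(p₂ * k)))
  have hn : ∀ x, StrictMono (nn x) ∨ ∃ᶠ i in atTop, nn x i = 0 := fun x =>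
    strictMono_or_frequently_eq_zero p₁ p₂ hp₁'.le hp₂'.le _ _ (hE₁ x) (hE₂ x) (ha₁ x) (ha₂ x)
      (hsum₁ x) (hsum₂ x) _ (hnnrec x)
  have hσ₁' : ∀ x, ∑' i, D₁ x (nn x i) ≤ M * σ₁ (k + 1) x := fun x => by
    rw [hσ₁]
    refine (tsum_chain_le p₁ hp₁'.le _ (hE₁ x) (ha₁ x) (hsum₁ x) k _ (hnn0 x) (hn x)).trans ?_
    exact mul_le_mul_of_nonneg_right (le_max_left _ _)
      (tsum_nonneg fun l => mul_nonneg (by positivity) (hE₁ _ _))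
  have hσ₂' : ∀ x, ∑' i, D₂ x (nn x i) ≤ M * σ₂ (k + 1) x := fun x => by
    rw [hσ₂]
    refine (tsum_chain_le p₂ hp₂'.le _ (hE₂ x) (ha₂ x) (hsum₂ x) k _ (hnn0 x) (hn x)).trans ?_
    exact mul_le_mul_of_nonneg_right (le_max_right _ _)
      (tsum_nonneg fun l => mul_nonneg (by positivity) (hE₂ _ _))
  have hgeom : ∀ p : ℝ, 0 < p → (2:ℝ) ^ (-(p * k)) ≤ M →
      1 ≤ M * (((2:ℝ) ^ (p * ((k : ℝ) + 1)) - 1) / ((2:ℝ) ^ p - 1)) := fun p hp hM =>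
    (one_le_rpow_neg_mul_geom p hp k).trans <| mul_le_mul_of_nonneg_right hM <|
      div_nonneg (sub_nonneg.2 (Real.one_le_rpow one_le_two (by positivity)))
        (sub_nonneg.2 (Real.one_le_rpow one_le_two hp.le))
  have h₁ := le_mul_of_one_le_left (hd₁0 s t) (hgeom p₁ hp₁' (le_max_left _ _))
  have h₂ := le_mul_of_one_le_left (hd₂0 s t) (hgeom p₂ hp₂' (le_max_right _ _))
  linarith [hσ₁' s, hσ₁' t, hσ₂' s, hσ₂' t]
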